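/- arXiv:2309.12948 — 2 statements merged into one kernel-verified Lean document; each statement's English description precedes it below -/
import Mathlib

section
/- Let N ≥ 2 be an integer, let s ∈ (1/2, 1) and let r₀ ∈ (0, 1). Then there exists a constant C > 0, depending only on N, s and r₀, such that for every measurable radial function u : ℝ^N → ℝ with ∫_{B_1} u² dx < ∞ and finite Gagliardo seminorm [u]_s on B_1, one has esssup_{B_1 \ closure(B_{r₀})} |u| ≤ C ( (∫_{B_1} u² dx)^{1/2} + [u]_s ). -/
open MeasureTheory Metric

/-- The squared `L²` integral of `u` on the unit ball, as an extended nonnegative real. -/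
noncomputable def sqIntegral (N : ℕ) (u : EuclideanSpace ℝ (Fin N) → ℝ) : ENNReal :=
  ∫⁻ x in ball (0 : EuclideanSpace ℝ (Fin N)) 1, ENNReal.ofReal ((u x) ^ 2)

/-- The squared Gagliardo seminorm of `u` on the unit ball. -/
noncomputable def gagliardoSq (N : ℕ) (s : ℝ) (u : EuclideanSpace ℝ (Fin N) → ℝ) : ENNReal :=
  ∫⁻ x in ball (0 : EuclideanSpace ℝ (Fin N)) 1,
    ∫⁻ y in ball (0 : EuclideanSpace ℝ (Fin N)) 1,
      ENNReal.ofReal ((u x - u y) ^ 2 / ‖x - y‖ ^ ((N : ℝ) + 2 * s))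

section Aux
open Set Filter Topology ENNReal

noncomputable def JJ (N : ℕ) (u : EuclideanSpace ℝ (Fin N) → ℝ)
    (w : EuclideanSpace ℝ (Fin N)) (R : ℝ) : ENNReal :=
  ∫⁻ y in closedBall w R ∩ ball 0 1, ∫⁻ z in closedBall w R ∩ ball 0 1,
    ENNReal.ofReal ((u y - u z) ^ 2)

lemma JJ_rot {N : ℕ} {u : EuclideanSpace ℝ (Fin N) → ℝ}
    (hu : ∀ x y : EuclideanSpace ℝ (Fin N), ‖x‖ = ‖y‖ → u x = u y)
    {w w' : EuclideanSpace ℝ (Fin N)} (h : ‖w‖ = ‖w'‖) (R : ℝ) :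
    JJ N u w R = JJ N u w' R := by
  obtain ⟨e, he⟩ : ∃ e : EuclideanSpace ℝ (Fin N) ≃ₗᵢ[ℝ] EuclideanSpace ℝ (Fin N), e w = w' :=
    ⟨_, Submodule.reflection_sub h⟩
  have hpre : e ⁻¹' (closedBall w' R ∩ ball 0 1) = closedBall w R ∩ ball 0 1 := by
    ext x
    simp [← he, dist_eq_norm]
  have hue : ∀ x, u (e x) = u x := fun x => hu _ _ (e.norm_map x)
  have hm : MeasurePreserving e volume volume := e.measurePreserving
  have hemb : MeasurableEmbedding e := e.toHomeomorph.measurableEmbedding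
  unfold JJ
  rw [← hm.setLIntegral_comp_preimage_emb hemb _ (closedBall w' R ∩ ball 0 1), hpre]
  congr 1
  ext y
  rw [← hm.setLIntegral_comp_preimage_emb hemb _ (closedBall w' R ∩ ball 0 1), hpre]
  simp only [hue]

lemma JJ_mono {N : ℕ} {u : EuclideanSpace ℝ (Fin N) → ℝ}
    {w w' : EuclideanSpace ℝ (Fin N)} {R R' : ℝ} (h : closedBall w R ⊆ closedBall w' R') :
    JJ N u w R ≤ JJ N u w' R' := by
  unfold JJ
  have h2 : closedBall w R ∩ ball 0 1 ⊆ closedBall w' R' ∩ ball 0 1 :=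
    inter_subset_inter_left _ h
  refine (lintegral_mono_set h2).trans (lintegral_mono fun y => lintegral_mono_set h2)

lemma JJ_compare {N : ℕ} {u : EuclideanSpace ℝ (Fin N) → ℝ}
    (hu : ∀ x y : EuclideanSpace ℝ (Fin N), ‖x‖ = ‖y‖ → u x = u y)
    {w w' : EuclideanSpace ℝ (Fin N)} {R : ℝ} (hw : w ≠ 0) (h : |‖w'‖ - ‖w‖| ≤ R) :
    JJ N u w R ≤ JJ N u w' (2 * R) := by
  have hw0 : ‖w‖ ≠ 0 := norm_ne_zero_iff.2 hw
  have h1 : ‖(‖w'‖ / ‖w‖) • w‖ = ‖w'‖ := by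
    rw [norm_smul, norm_div, norm_norm, norm_norm, div_mul_cancel₀ _ hw0]
  rw [← JJ_rot hu h1]
  apply JJ_mono
  apply closedBall_subset_closedBall'
  have : dist w ((‖w'‖ / ‖w‖) • w) ≤ R := by
    rw [dist_comm, dist_eq_norm]
    have : (‖w'‖ / ‖w‖) • w - w = ((‖w'‖ - ‖w‖) / ‖w‖) • w := by
      rw [sub_div, div_self hw0, sub_smul, one_smul]
    rw [this, norm_smul, norm_div, norm_norm, div_mul_cancel₀ _ hw0]
    exact h
  linarith

lemma JJ_integral {N : ℕ} (s : ℝ) (hs : 0 < s) {u : EuclideanSpace ℝ (Fin N) → ℝ}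
    (hum : Measurable u) {R : ℝ} (hR : 0 ≤ R) :
    ∫⁻ w, JJ N u w R ≤ ENNReal.ofReal ((2 * R) ^ ((N : ℝ) + 2 * s)) *
      (ENNReal.ofReal (R ^ N) * volume (ball (0 : EuclideanSpace ℝ (Fin N)) 1)) *
        gagliardoSq N s u := by
  set K : EuclideanSpace ℝ (Fin N) → EuclideanSpace ℝ (Fin N) → ENNReal := fun y z =>
    ENNReal.ofReal ((u y - u z) ^ 2 / ‖y - z‖ ^ ((N : ℝ) + 2 * s)) with hK
  have hKm : Measurable (Function.uncurry K) := by
    simp only [hK, Function.uncurry_def]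
    fun_prop
  set g : EuclideanSpace ℝ (Fin N) → ENNReal := fun y => ∫⁻ z in ball 0 1, K y z with hg
  have hgm : Measurable g := hKm.lintegral_prod_right'
  set c := ENNReal.ofReal ((2 * R) ^ ((N : ℝ) + 2 * s)) with hc
  have hp : 0 < (N : ℝ) + 2 * s := by positivity
  have key : ∀ w, JJ N u w R ≤ c * ∫⁻ y in ball 0 1, (closedBall w R).indicator g y := by
    intro w
    unfold JJ
    rw [setLIntegral_indicator measurableSet_closedBall, ← lintegral_const_mul c hgm]
    refine setLIntegral_mono (hgm.const_mul c) fun y hy => ?_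
    have hKy : Measurable (fun z => K y z) := hKm.comp measurable_prodMk_left
    simp only [hg]
    rw [← lintegral_const_mul c hKy]
    refine le_trans ?_ (lintegral_mono_set (inter_subset_right (s := closedBall w R)))
    refine setLIntegral_mono ((hKm.comp measurable_prodMk_left).const_mul c) fun z hz => ?_
    simp only [hK, hc]
    rw [← ENNReal.ofReal_mul (by positivity)]
    apply ENNReal.ofReal_le_ofReal
    by_cases hyz : y = z
    · subst hyz; simp
    have hpos : 0 < ‖y - z‖ := norm_pos_iff.2 (sub_ne_zero.2 hyz)
    have hle : ‖y - z‖ ≤ 2 * R := by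
      rw [← dist_eq_norm]
      have h1 := mem_closedBall.1 hy.1
      have h2 := mem_closedBall'.1 hz.1
      linarith [dist_triangle y w z]
    rw [mul_div_assoc', le_div_iff₀ (by positivity), mul_comm]
    gcongr
  calc ∫⁻ w, JJ N u w R
      ≤ ∫⁻ w, c * ∫⁻ y in ball 0 1, (closedBall w R).indicator g y := lintegral_mono key
    _ = c * ∫⁻ w, ∫⁻ y in ball 0 1, (closedBall w R).indicator g y := by
        rw [lintegral_const_mul' _ _ (by simp [hc])]
    _ = c * ∫⁻ y in ball 0 1, ∫⁻ w, (closedBall w R).indicator g y := by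
        rw [lintegral_lintegral_swap]
        have : (Function.uncurry fun (w y : EuclideanSpace ℝ (Fin N)) =>
            (closedBall w R).indicator g y) =
            {p : EuclideanSpace ℝ (Fin N) × EuclideanSpace ℝ (Fin N) |
              dist p.2 p.1 ≤ R}.indicator (fun p => g p.2) := by
          ext p
          simp [indicator, Function.uncurry_def]
        rw [this]
        exact ((hgm.comp measurable_snd).indicator
          (measurableSet_le (by fun_prop) measurable_const)).aemeasurable
    _ = c * ∫⁻ y in ball 0 1,
          (ENNReal.ofReal (R ^ N) * volume (ball (0 : EuclideanSpace ℝ (Fin N)) 1)) * g y := by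
        congr 2
        ext y
        have : ∀ w, (closedBall w R).indicator g y = (closedBall y R).indicator (fun _ => g y) w := by
          intro w
          simp [indicator, dist_comm]
        simp_rw [this]
        rw [lintegral_indicator_const measurableSet_closedBall,
          Measure.addHaar_closedBall _ _ hR, finrank_euclideanSpace_fin, mul_comm]
    _ = _ := by
        rw [lintegral_const_mul _ hgm, ← mul_assoc]
        rfl

lemma shell_vol {N : ℕ} (hN : 1 ≤ N) {a ρ : ℝ} (ha : 0 < a) (hρ : 0 < ρ) :
    ENNReal.ofReal (a ^ (N - 1) * ρ) * volume (ball (0 : EuclideanSpace ℝ (Fin N)) 1) ≤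
      volume (closedBall (0 : EuclideanSpace ℝ (Fin N)) (a + ρ) \ closedBall 0 a) := by
  refine le_trans ?_ le_measure_sdiff
  rw [Measure.addHaar_closedBall _ _ (by positivity), Measure.addHaar_closedBall _ _ ha.le,
    finrank_euclideanSpace_fin]
  have hW : volume (ball (0 : EuclideanSpace ℝ (Fin N)) 1) ≠ ⊤ := measure_ball_lt_top.ne
  refine ENNReal.le_sub_of_add_le_right (ENNReal.mul_ne_top (by simp) hW) ?_
  rw [← add_mul, ← ENNReal.ofReal_add (by positivity) (by positivity)]
  gcongr
  obtain ⟨n, rfl⟩ : ∃ n, N = n + 1 := ⟨N - 1, by omega⟩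
  simp only [Nat.add_sub_cancel]
  have : a ^ n ≤ (a + ρ) ^ n := by gcongr; linarith
  calc a ^ n * ρ + a ^ (n + 1) = a ^ n * (a + ρ) := by ring
    _ ≤ (a + ρ) ^ n * (a + ρ) := by gcongr
    _ = _ := by ring

lemma JJ_bound {N : ℕ} (hN : 1 ≤ N) (s : ℝ) (hs : 0 < s) {u : EuclideanSpace ℝ (Fin N) → ℝ}
    (hum : Measurable u)
    (hu : ∀ x y : EuclideanSpace ℝ (Fin N), ‖x‖ = ‖y‖ → u x = u y)
    (hG : gagliardoSq N s u < ⊤)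
    {w : EuclideanSpace ℝ (Fin N)} {ρ a : ℝ} (hρ : 0 < ρ) (ha : 0 < a) (haw : a ≤ ‖w‖) :
    JJ N u w ρ ≤ ENNReal.ofReal ((4 * ρ) ^ ((N : ℝ) + 2 * s) * (2 * ρ) ^ N / (a ^ (N - 1) * ρ) *
      (gagliardoSq N s u).toReal) := by
  set W := volume (ball (0 : EuclideanSpace ℝ (Fin N)) 1) with hWd
  have hW : W ≠ ⊤ := measure_ball_lt_top.ne
  have hW0 : W ≠ 0 := (measure_ball_pos _ _ one_pos).ne'
  have hw : w ≠ 0 := by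
    rintro rfl
    simp at haw; linarith
  have h1 : JJ N u w ρ * (ENNReal.ofReal (a ^ (N - 1) * ρ) * W) ≤
      ENNReal.ofReal ((4 * ρ) ^ ((N : ℝ) + 2 * s)) *
      (ENNReal.ofReal ((2 * ρ) ^ N) * W) * gagliardoSq N s u := by
    calc JJ N u w ρ * (ENNReal.ofReal (a ^ (N - 1) * ρ) * W)
        ≤ JJ N u w ρ * (ENNReal.ofReal (‖w‖ ^ (N - 1) * ρ) * W) := by gcongr
      _ ≤ JJ N u w ρ * volume (closedBall (0 : EuclideanSpace ℝ (Fin N)) (‖w‖ + ρ) \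
            closedBall 0 ‖w‖) := by
          gcongr
          exact shell_vol hN (by linarith) hρ
      _ = ∫⁻ w' in closedBall (0 : EuclideanSpace ℝ (Fin N)) (‖w‖ + ρ) \
            closedBall 0 ‖w‖, JJ N u w ρ := by rw [setLIntegral_const]
      _ ≤ ∫⁻ w' in closedBall (0 : EuclideanSpace ℝ (Fin N)) (‖w‖ + ρ) \
            closedBall 0 ‖w‖, JJ N u w' (2 * ρ) := by
          refine setLIntegral_mono' (measurableSet_closedBall.diff measurableSet_closedBall) ?_
          intro w' hw'
          apply JJ_compare hu hw
          simp at hw'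
          rw [abs_le]; constructor <;> linarith
      _ ≤ ∫⁻ w', JJ N u w' (2 * ρ) := setLIntegral_le_lintegral _ _
      _ ≤ _ := by
          have := JJ_integral (N := N) s hs hum (R := 2 * ρ) (by positivity)
          rwa [show 2 * (2 * ρ) = 4 * ρ by ring] at this
  rw [show ENNReal.ofReal ((4 * ρ) ^ ((N : ℝ) + 2 * s)) *
      (ENNReal.ofReal ((2 * ρ) ^ N) * W) * gagliardoSq N s u =
      (ENNReal.ofReal ((4 * ρ) ^ ((N : ℝ) + 2 * s)) *
      ENNReal.ofReal ((2 * ρ) ^ N) * gagliardoSq N s u) * W by ring, ← mul_assoc,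
      ENNReal.mul_le_mul_iff_left hW0 hW, ← ENNReal.ofReal_toReal hG.ne,
      ← ENNReal.ofReal_mul (by positivity), ← ENNReal.ofReal_mul (by positivity)] at h1
  rw [← ENNReal.le_div_iff_mul_le (by left; simp; positivity) (by simp),
    ← ENNReal.ofReal_div_of_pos (by positivity)] at h1
  refine h1.trans (le_of_eq ?_)
  congr 1
  ring

lemma jensen_sq {α : Type*} [MeasurableSpace α] (μ : Measure α) [IsProbabilityMeasure μ]
    (f : α → ℝ) (hf : AEStronglyMeasurable f μ) :
    ENNReal.ofReal ((∫ x, f x ∂μ) ^ 2) ≤ ∫⁻ x, ENNReal.ofReal ((f x) ^ 2) ∂μ := by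
  have h1 : ‖∫ x, f x ∂μ‖ₑ ≤ eLpNorm f 2 μ :=
    (enorm_integral_le_lintegral_enorm f).trans
      (by rw [← eLpNorm_one_eq_lintegral_enorm]
          exact eLpNorm_le_eLpNorm_of_exponent_le (by norm_num) hf)
  have h2 : eLpNorm f 2 μ ^ 2 = ∫⁻ x, ENNReal.ofReal ((f x) ^ 2) ∂μ := by
    rw [eLpNorm_eq_lintegral_rpow_enorm_toReal (by norm_num) (by norm_num), ← ENNReal.rpow_natCast,
      ← ENNReal.rpow_mul]
    simp only [ENNReal.toReal_ofNat, Nat.cast_ofNat, one_div]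
    rw [inv_mul_cancel₀ (by norm_num), ENNReal.rpow_one]
    congr 1; ext x
    rw [Real.enorm_eq_ofReal_abs, ENNReal.ofReal_rpow_of_nonneg (by positivity) (by norm_num)]
    norm_num
  rw [← h2, ← sq_abs, ENNReal.ofReal_pow (by positivity), ← Real.enorm_eq_ofReal_abs]
  gcongr

lemma avg_sq_le {α : Type*} [MeasurableSpace α] (μ : Measure α) {B : Set α} (hB0 : μ B ≠ 0)
    (hB : μ B ≠ ⊤) (f : α → ℝ) (hf : Measurable f) :
    ENNReal.ofReal ((⨍ x in B, f x ∂μ) ^ 2) ≤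
      (μ B)⁻¹ * ∫⁻ x in B, ENNReal.ofReal ((f x) ^ 2) ∂μ := by
  have : IsProbabilityMeasure ((μ.restrict B univ)⁻¹ • μ.restrict B) := by
    constructor
    simp [ENNReal.inv_mul_cancel hB0 hB]
  have := jensen_sq ((μ.restrict B univ)⁻¹ • μ.restrict B) f hf.aestronglyMeasurable
  rw [lintegral_smul_measure] at this
  simpa [average] using this

lemma avg_diff {α : Type*} [MeasurableSpace α] (μ : Measure α) {A B : Set α} (hA0 : μ A ≠ 0)
    (hA : μ A ≠ ⊤) (hB0 : μ B ≠ 0)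
    (hB : μ B ≠ ⊤) (f : α → ℝ) (hf : Measurable f) (hfA : IntegrableOn f A μ)
    (hfB : IntegrableOn f B μ) :
    ENNReal.ofReal ((⨍ x in A, f x ∂μ - ⨍ x in B, f x ∂μ) ^ 2) ≤
      (μ A)⁻¹ * ((μ B)⁻¹ * ∫⁻ y in A, ∫⁻ z in B, ENNReal.ofReal ((f y - f z) ^ 2) ∂μ ∂μ) := by
  have hsub : ∀ (S : Set α), μ S ≠ 0 → μ S ≠ ⊤ → IntegrableOn f S μ → ∀ c : ℝ,
      ⨍ x in S, (f x - c) ∂μ = ⨍ x in S, f x ∂μ - c := by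
    intro S hS0 hS hfS c
    have : (μ.real S) ≠ 0 := (ENNReal.toReal_pos hS0 hS).ne'
    rw [setAverage_eq, setAverage_eq, integral_sub hfS (integrableOn_const hS)]
    simp only [smul_eq_mul, setIntegral_const]
    field_simp
  rw [← hsub A hA0 hA hfA]
  refine (avg_sq_le μ hA0 hA _ (hf.sub_const _)).trans ?_
  gcongr
  rw [← lintegral_const_mul' _ _ (ENNReal.inv_ne_top.2 hB0)]
  refine lintegral_mono fun y => ?_
  have : (f y - ⨍ x in B, f x ∂μ) ^ 2 = (⨍ x in B, (f x - f y) ∂μ) ^ 2 := by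
    rw [hsub B hB0 hB hfB]; ring
  rw [this]
  refine (avg_sq_le μ hB0 hB _ (hf.sub_const _)).trans (le_of_eq ?_)
  congr 2; ext z; congr 1; ring

lemma int_on {N : ℕ} {u : EuclideanSpace ℝ (Fin N) → ℝ} (hum : Measurable u)
    (hS : sqIntegral N u < ⊤) :
    IntegrableOn u (ball (0 : EuclideanSpace ℝ (Fin N)) 1) volume := by
  have : IsFiniteMeasure (volume.restrict (ball (0 : EuclideanSpace ℝ (Fin N)) 1)) :=
    ⟨by simpa using measure_ball_lt_top⟩
  have h : MemLp u 2 (volume.restrict (ball (0 : EuclideanSpace ℝ (Fin N)) 1)) := by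
    rw [memLp_two_iff_integrable_sq hum.aestronglyMeasurable]
    refine ⟨(hum.pow_const 2).aestronglyMeasurable, ?_⟩
    rw [hasFiniteIntegral_iff_ofReal (ae_of_all _ fun x => sq_nonneg _)]
    exact hS
  exact h.integrable (by norm_num)

lemma step_bound {N : ℕ} (hN : 1 ≤ N) (s : ℝ) (hs : 0 < s) {u : EuclideanSpace ℝ (Fin N) → ℝ}
    (hum : Measurable u)
    (hu : ∀ x y : EuclideanSpace ℝ (Fin N), ‖x‖ = ‖y‖ → u x = u y)
    (hS : sqIntegral N u < ⊤)
    (hG : gagliardoSq N s u < ⊤)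
    {w w' : EuclideanSpace ℝ (Fin N)} {ρ a : ℝ} (hρ : 0 < ρ) (ha : 0 < a) (haw : a ≤ ‖w‖)
    (hsub : closedBall w ρ ⊆ ball 0 1) (hsub' : closedBall w' (ρ / 2) ⊆ closedBall w ρ) :
    ((⨍ y in closedBall w' (ρ / 2), u y) - ⨍ y in closedBall w ρ, u y) ^ 2 ≤
      (4 : ℝ) ^ ((N : ℝ) + 2 * s) * 4 ^ N /
        (a ^ (N - 1) * (volume (ball (0 : EuclideanSpace ℝ (Fin N)) 1)).toReal ^ 2) *
        ρ ^ (2 * s - 1) * (gagliardoSq N s u).toReal := by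
  have hint := int_on hum hS
  set W := volume (ball (0 : EuclideanSpace ℝ (Fin N)) 1) with hWd
  have hW : W ≠ ⊤ := measure_ball_lt_top.ne
  have hW0 : W ≠ 0 := (measure_ball_pos _ _ one_pos).ne'
  have hWp : 0 < W.toReal := ENNReal.toReal_pos hW0 hW
  have hv : ∀ (z : EuclideanSpace ℝ (Fin N)) (r : ℝ), 0 ≤ r →
      volume (closedBall z r) = ENNReal.ofReal (r ^ N * W.toReal) := by
    intro z r hr
    rw [Measure.addHaar_closedBall _ _ hr, finrank_euclideanSpace_fin,
      ENNReal.ofReal_mul (by positivity), ENNReal.ofReal_toReal hW]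
  have h1 := avg_diff volume (A := closedBall w' (ρ / 2)) (B := closedBall w ρ)
    (measure_closedBall_pos _ _ (by positivity)).ne' measure_closedBall_lt_top.ne
    (measure_closedBall_pos _ _ (by positivity)).ne' measure_closedBall_lt_top.ne
    u hum (hint.mono_set (hsub'.trans hsub)) (hint.mono_set hsub)
  have h2 : ∫⁻ y in closedBall w' (ρ / 2), ∫⁻ z in closedBall w ρ,
      ENNReal.ofReal ((u y - u z) ^ 2) ≤ JJ N u w ρ := by
    unfold JJ
    rw [inter_eq_left.2 hsub]
    exact lintegral_mono_set hsub'
  have h3 := h2.trans (JJ_bound hN s hs hum hu hG hρ ha haw)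
  have h4 := h1.trans (mul_le_mul_right (mul_le_mul_right h3 _) _)
  rw [hv _ _ (by positivity), hv _ _ hρ.le, ← ENNReal.ofReal_inv_of_pos (by positivity),
    ← ENNReal.ofReal_inv_of_pos (by positivity), ← ENNReal.ofReal_mul (by positivity),
    ← ENNReal.ofReal_mul (by positivity), ENNReal.ofReal_le_ofReal_iff (by positivity)] at h4
  refine h4.trans (le_of_eq ?_)
  rw [Real.mul_rpow (by norm_num) hρ.le, Real.rpow_sub hρ, Real.rpow_one,
    Real.rpow_add hρ, Real.rpow_natCast, mul_pow, div_pow,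
    show (4 : ℝ) ^ N = 2 ^ N * 2 ^ N by rw [← mul_pow]; norm_num]
  field_simp

lemma point_bound {N : ℕ} (hN : 1 ≤ N) (s : ℝ) (hs : 1 / 2 < s)
    (r₀ : ℝ) (hr₀ : 0 < r₀) (hr₀1 : r₀ < 1) :
    ∃ C : ℝ, 0 < C ∧ ∀ u : EuclideanSpace ℝ (Fin N) → ℝ, Measurable u →
        (∀ x y : EuclideanSpace ℝ (Fin N), ‖x‖ = ‖y‖ → u x = u y) →
        sqIntegral N u < ⊤ →
        gagliardoSq N s u < ⊤ → ∀ᵐ x : EuclideanSpace ℝ (Fin N), ‖x‖ < 1 → r₀ < ‖x‖ →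
        |u x| ≤ C * (√(sqIntegral N u).toReal + √(gagliardoSq N s u).toReal) := by
  set W := volume (ball (0 : EuclideanSpace ℝ (Fin N)) 1) with hWd
  have hW : W ≠ ⊤ := measure_ball_lt_top.ne
  have hW0 : W ≠ 0 := (measure_ball_pos _ _ one_pos).ne'
  have hWp : 0 < W.toReal := ENNReal.toReal_pos hW0 hW
  set K := (4 : ℝ) ^ ((N : ℝ) + 2 * s) * 4 ^ N / ((r₀ / 2) ^ (N - 1) * W.toReal ^ 2) with hK
  have hKp : 0 < K := by positivity
  set q : ℝ := (1 / 2) ^ (s - 1 / 2) with hq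
  have hq0 : 0 < q := by positivity
  have hq1 : q < 1 := Real.rpow_lt_one (by norm_num) (by norm_num) (by linarith)
  set D := √(K * (r₀ / 4) ^ (2 * s - 1)) with hD
  set M := √(((r₀ / 4) ^ N * W.toReal)⁻¹) with hM
  have hD0 : 0 < D := by positivity
  have hM0 : 0 < M := by positivity
  have h1q : 0 < 1 - q := by linarith
  refine ⟨M + D / (1 - q), by positivity, fun u hum hu hS hG => ?_⟩
  have hint := int_on hum hS
  have hloc : LocallyIntegrable ((ball (0 : EuclideanSpace ℝ (Fin N)) 1).indicator u) volume :=
    (hint.integrable_indicator measurableSet_ball).locallyIntegrable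
  filter_upwards [IsUnifLocDoublingMeasure.ae_tendsto_average (μ := volume) hloc 1] with x hx hx1 hx0
  set ρ : ℕ → ℝ := fun k => r₀ / 4 * (1 / 2) ^ k with hρ
  have hρp : ∀ k, 0 < ρ k := fun k => by positivity
  have hρle : ∀ k, ρ k ≤ r₀ / 4 := fun k => by
    have : ((1 : ℝ) / 2) ^ k ≤ 1 := pow_le_one₀ (by norm_num) (by norm_num)
    simp only [hρ]; nlinarith
  have hρs : ∀ k, ρ (k + 1) = ρ k / 2 := fun k => by simp only [hρ, pow_succ]; ring
  set w : ℕ → EuclideanSpace ℝ (Fin N) := fun k => (1 - ρ k) • x with hw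
  have hwn : ∀ k, ‖w k‖ = (1 - ρ k) * ‖x‖ := fun k => by
    rw [hw, norm_smul, Real.norm_of_nonneg]
    linarith [hρle k]
  have hlim : Tendsto ρ atTop (𝓝[>] 0) := by
    refine tendsto_nhdsWithin_iff.2 ⟨?_, Eventually.of_forall hρp⟩
    have := (tendsto_pow_atTop_nhds_zero_of_lt_one (r := (1 / 2 : ℝ)) (by norm_num)
      (by norm_num)).const_mul (r₀ / 4)
    simpa [hρ] using this
  have hdist : ∀ k, dist x (w k) ≤ ρ k := fun k => by
    rw [dist_eq_norm, show x - w k = ρ k • x by simp only [hw, sub_smul, one_smul]; abel,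
      norm_smul, Real.norm_of_nonneg (hρp k).le]
    nlinarith [hρp k]
  have hsub : ∀ k, closedBall (w k) (ρ k) ⊆ ball 0 1 := fun k => by
    apply closedBall_subset_ball'
    rw [dist_zero_right, hwn]
    nlinarith [hρp k, hρle k]
  have hnest : ∀ k, closedBall (w (k + 1)) (ρ k / 2) ⊆ closedBall (w k) (ρ k) := fun k => by
    apply closedBall_subset_closedBall'
    rw [dist_eq_norm, show w (k + 1) - w k = (ρ k / 2) • x by
      simp only [hw, hρs, ← sub_smul]; congr 1; ring,
      norm_smul, Real.norm_of_nonneg (by linarith [hρp k])]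
    nlinarith [hρp k]
  have hlow : ∀ k, r₀ / 2 ≤ ‖w k‖ := fun k => by
    rw [hwn]; nlinarith [hρp k, hρle k]
  set b : ℕ → ℝ := fun k => ⨍ y in closedBall (w k) (ρ k), u y with hb
  have hbt : Tendsto b atTop (𝓝 (u x)) := by
    have := hx w ρ hlim (Eventually.of_forall fun k => by
      rw [one_mul]; exact mem_closedBall.2 (hdist k))
    rw [indicator_of_mem (by simpa using hx1)] at this
    refine this.congr fun k => ?_
    refine setAverage_congr_fun measurableSet_closedBall (ae_of_all _ fun y hy => ?_)
    exact indicator_of_mem (hsub k hy) _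
  have hstep : ∀ k, dist (b k) (b (k + 1)) ≤ D * √(gagliardoSq N s u).toReal * q ^ k := fun k => by
    have h := step_bound hN s (by linarith) hum hu hS hG (hρp k) (by positivity) (hlow k)
      (hsub k) (hnest k)
    rw [← hWd, ← hK] at h
    rw [dist_comm, Real.dist_eq]
    apply abs_le_of_sq_le_sq' _ (by positivity) |> abs_le.2
    simp only [hb, hρs]
    refine h.trans (le_of_eq ?_)
    rw [mul_pow, mul_pow, hD, Real.sq_sqrt (by positivity), Real.sq_sqrt (by positivity)]
    have : (ρ k) ^ (2 * s - 1) = (r₀ / 4) ^ (2 * s - 1) * (q ^ k) ^ 2 := by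
      simp only [hρ]
      rw [Real.mul_rpow (by positivity) (by positivity), hq]
      congr 1
      rw [← Real.rpow_natCast, ← Real.rpow_natCast, ← Real.rpow_natCast, ← Real.rpow_mul (by positivity),
        ← Real.rpow_mul (by positivity), ← Real.rpow_mul (by positivity)]
      congr 1
      push_cast; ring
    rw [this]; ring
  have hfin := dist_le_of_le_geometric_of_tendsto₀ q _ hq1 hstep hbt
  have hb0 : |b 0| ≤ M * √(sqIntegral N u).toReal := by
    have h := avg_sq_le volume (B := closedBall (w 0) (ρ 0))
      (measure_closedBall_pos _ _ (hρp 0)).ne' measure_closedBall_lt_top.ne u hum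
    have h' : ∫⁻ y in closedBall (w 0) (ρ 0), ENNReal.ofReal ((u y) ^ 2) ≤ sqIntegral N u :=
      lintegral_mono_set (hsub 0)
    have h2 := h.trans (mul_le_mul_right h' _)
    rw [Measure.addHaar_closedBall _ _ (hρp 0).le, finrank_euclideanSpace_fin, ← hWd,
      ← ENNReal.ofReal_toReal hW, ← ENNReal.ofReal_mul (by have := hρp 0; positivity),
      ← ENNReal.ofReal_inv_of_pos (by have := hρp 0; positivity), ← ENNReal.ofReal_toReal hS.ne,
      ← ENNReal.ofReal_mul (by have := hρp 0; positivity),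
      ENNReal.ofReal_le_ofReal_iff (by have := hρp 0; positivity)] at h2
    rw [hM, ← Real.sqrt_mul (by positivity)]
    apply Real.abs_le_sqrt
    simpa [hb, hρ] using h2
  rw [Real.dist_eq] at hfin
  have h3 : |u x| ≤ |b 0| + |b 0 - u x| := by
    have := abs_sub_abs_le_abs_sub (u x) (b 0)
    rw [abs_sub_comm] at this; linarith
  have hs1 := Real.sqrt_nonneg (sqIntegral N u).toReal
  have hs2 := Real.sqrt_nonneg (gagliardoSq N s u).toReal
  have h4 : D * √(gagliardoSq N s u).toReal / (1 - q) = D / (1 - q) * √(gagliardoSq N s u).toReal := by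
    ring
  rw [h4] at hfin
  have h5 : 0 ≤ D / (1 - q) * √(sqIntegral N u).toReal := by positivity
  have h6 : 0 ≤ M * √(gagliardoSq N s u).toReal := by positivity
  linarith

end Aux

/-- radial trace-type `L^∞` bound away from the origin, by the `L²` norm plus
the fractional Gagliardo seminorm of order `s ∈ (1/2, 1)`. -/
theorem radial_essSup_annulus_bound
    (N : ℕ) (hN : 2 ≤ N) (s : ℝ) (hs : 1 / 2 < s) (hs1 : s < 1)
    (r₀ : ℝ) (hr₀ : 0 < r₀) (hr₀1 : r₀ < 1) :
    ∃ C : ℝ, 0 < C ∧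
      ∀ u : EuclideanSpace ℝ (Fin N) → ℝ, Measurable u →
        (∀ x y : EuclideanSpace ℝ (Fin N), ‖x‖ = ‖y‖ → u x = u y) →
        sqIntegral N u < ⊤ →
        gagliardoSq N s u < ⊤ →
        essSup (fun x => ENNReal.ofReal |u x|)
            (volume.restrict
              (ball (0 : EuclideanSpace ℝ (Fin N)) 1 \
                closedBall (0 : EuclideanSpace ℝ (Fin N)) r₀)) ≤
          ENNReal.ofReal C *
            ((sqIntegral N u) ^ (1 / 2 : ℝ) + (gagliardoSq N s u) ^ (1 / 2 : ℝ)) := by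
  obtain ⟨C, hC, h⟩ := point_bound (N := N) (by omega) s hs r₀ hr₀ hr₀1
  refine ⟨C, hC, fun u hum hu hS hG => ?_⟩
  have hr : ∀ T : ENNReal, T < ⊤ → T ^ (1 / 2 : ℝ) = ENNReal.ofReal (√T.toReal) := by
    intro T hT
    rw [Real.sqrt_eq_rpow, ← ENNReal.ofReal_rpow_of_nonneg ENNReal.toReal_nonneg (by norm_num),
      ENNReal.ofReal_toReal hT.ne]
  rw [hr _ hS, hr _ hG, ← ENNReal.ofReal_add (by positivity) (by positivity),
    ← ENNReal.ofReal_mul hC.le]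
  refine essSup_le_of_ae_le _ ?_
  rw [Filter.EventuallyLE, ae_restrict_iff' (measurableSet_ball.diff measurableSet_closedBall)]
  filter_upwards [h u hum hu hS hG] with x hx hxm
  apply ENNReal.ofReal_le_ofReal
  simp only [Set.mem_sdiff, mem_ball, mem_closedBall, dist_zero_right, not_le] at hxm
  exact hx hxm.1 hxm.2
end

section
/- Let N ≥ 2 be an integer, s ∈ (1/2, 1), and p, q ≥ 2 be reals. Let a : (0,1) → ℝ be integrable, non-decreasing and positive a.e., and let b : (0,1) → ℝ be integrable, non-negative and non-increasing. Then there exists a constant C > 0 such that for every measurable radial function u : ℝ^N → ℝ that is non-negative and radially non-decreasing on B_1, with ∫_{B_1} u² dx < ∞ and finite Gagliardo seminorm [u]_s on B_1, one has (∫_{B_1} u² dx)^{1/2} + (∫_{B_1} a(|x|) |u(x)|^p dx)^{1/p} + (∫_{B_1} b(|x|) |u(x)|^q dx)^{1/q} ≤ C ( (∫_{B_1} u² dx)^{1/2} + [u]_s ). -/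
open MeasureTheory Metric

lemma shell_volume (N : ℕ) (hN : 2 ≤ N) (r R : ℝ) (hr : 0 ≤ r) (hR : 0 ≤ R) :
    ENNReal.ofReal ((R ^ N - r ^ N) *
      (volume (ball (0 : EuclideanSpace ℝ (Fin N)) 1)).toReal) ≤
    volume (ball (0 : EuclideanSpace ℝ (Fin N)) R \ ball 0 r) := by
  have : Nonempty (Fin N) := ⟨⟨0, by omega⟩⟩
  have hfin : volume (ball (0 : EuclideanSpace ℝ (Fin N)) 1) ≠ ⊤ := measure_ball_lt_top.ne
  refine le_trans ?_ le_measure_sdiff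
  rw [Measure.addHaar_ball _ _ hr, Measure.addHaar_ball _ _ hR, finrank_euclideanSpace_fin,
    sub_mul, ENNReal.ofReal_sub _ (by positivity), ENNReal.ofReal_mul (by positivity),
    ENNReal.ofReal_mul (by positivity), ENNReal.ofReal_toReal hfin]

lemma gagliardo_step (N : ℕ) (hN : 2 ≤ N) (s : ℝ) (hs : 1 / 2 < s)
    (u : EuclideanSpace ℝ (Fin N) → ℝ)
    (hmono : ∀ x y : EuclideanSpace ℝ (Fin N), ‖x‖ ≤ ‖y‖ → ‖y‖ < 1 → u x ≤ u y)
    (h : ℝ) (h0 : 0 < h) (h8 : h ≤ 1 / 8) (x₀ y₀ : EuclideanSpace ℝ (Fin N))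
    (hx₀ : ‖x₀‖ = 1 - 2 * h) (hy₀ : ‖y₀‖ = 1 - h) :
    ENNReal.ofReal (((u y₀ - u x₀) ^ 2 / (4 * h) ^ ((N : ℝ) + 2 * s) *
        ((h / 2) ^ N * (volume (ball (0 : EuclideanSpace ℝ (Fin N)) 1)).toReal)) *
        (((1 - 2 * h) ^ N - (1 - 4 * h) ^ N) *
          (volume (ball (0 : EuclideanSpace ℝ (Fin N)) 1)).toReal)) ≤ gagliardoSq N s u := by
  have : Nonempty (Fin N) := ⟨⟨0, by omega⟩⟩
  have hfin : volume (ball (0 : EuclideanSpace ℝ (Fin N)) 1) ≠ ⊤ := measure_ball_lt_top.ne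
  have hd : 0 ≤ u y₀ - u x₀ := sub_nonneg.2 (hmono _ _ (by linarith) (by linarith))
  rw [ENNReal.ofReal_mul (by positivity)]
  have hA : MeasurableSet
      (ball (0 : EuclideanSpace ℝ (Fin N)) (1 - 2 * h) \ ball 0 (1 - 4 * h)) :=
    measurableSet_ball.diff measurableSet_ball
  refine le_trans (mul_le_mul_right (shell_volume N hN (1 - 4 * h) (1 - 2 * h)
    (by linarith) (by linarith)) _) ?_
  rw [← setLIntegral_const]
  unfold gagliardoSq
  refine le_trans (setLIntegral_mono' hA (g := fun x => ∫⁻ y in ball (0 : EuclideanSpace ℝ (Fin N)) 1,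
      ENNReal.ofReal ((u x - u y) ^ 2 / ‖x - y‖ ^ ((N : ℝ) + 2 * s))) ?_) (lintegral_mono_set ?_)
  · intro x hx
    simp only [Set.mem_sdiff, mem_ball, dist_zero_right, not_lt] at hx
    obtain ⟨hx1, hx2⟩ := hx
    have hxpos : 0 < ‖x‖ := by linarith
    set z : EuclideanSpace ℝ (Fin N) := ((1 - h / 2) / ‖x‖) • x with hz
    have hzn : ‖z‖ = 1 - h / 2 := by
      rw [hz, norm_smul, Real.norm_of_nonneg (div_nonneg (by linarith) hxpos.le)]
      field_simp
    have hxz : ‖x - z‖ = 1 - h / 2 - ‖x‖ := by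
      have : x - z = -((((1 - h / 2) / ‖x‖) - 1) • x) := by rw [hz, sub_smul, one_smul]; abel
      rw [this, norm_neg, norm_smul, Real.norm_of_nonneg]
      · field_simp
      · rw [sub_nonneg, le_div_iff₀ hxpos]; linarith
    have hball : ∀ y ∈ ball z (h / 2), 1 - h < ‖y‖ ∧ ‖y‖ < 1 ∧ ‖x - y‖ ≤ 4 * h := by
      intro y hy
      rw [mem_ball, dist_eq_norm] at hy
      have h1 := norm_sub_norm_le y z
      have h2 := norm_sub_norm_le z y
      rw [norm_sub_rev] at h2
      have h3 : ‖x - y‖ ≤ ‖x - z‖ + ‖y - z‖ := by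
        rw [norm_sub_rev y z]
        exact norm_sub_le_norm_sub_add_norm_sub x z y
      refine ⟨by linarith, by linarith, by linarith⟩
    have hvol : ENNReal.ofReal ((h / 2) ^ N *
        (volume (ball (0 : EuclideanSpace ℝ (Fin N)) 1)).toReal) = volume (ball z (h / 2)) := by
      rw [Measure.addHaar_ball _ z (by positivity), finrank_euclideanSpace_fin,
        ENNReal.ofReal_mul (by positivity), ENNReal.ofReal_toReal hfin]
    rw [ENNReal.ofReal_mul (by positivity), hvol, ← setLIntegral_const]
    refine le_trans (setLIntegral_mono' measurableSet_ball
      (g := fun y => ENNReal.ofReal ((u x - u y) ^ 2 / ‖x - y‖ ^ ((N : ℝ) + 2 * s))) ?_)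
      (lintegral_mono_set ?_)
    · intro y hy
      obtain ⟨hy1, hy2, hy3⟩ := hball y hy
      have hxy : 0 < ‖x - y‖ := by
        rw [norm_pos_iff, sub_ne_zero]
        rintro rfl
        linarith
      have e1 : u x ≤ u x₀ := hmono _ _ (by linarith) (by linarith)
      have e2 : u y₀ ≤ u y := hmono _ _ (by linarith) (by linarith)
      apply ENNReal.ofReal_le_ofReal
      apply div_le_div₀ (by positivity)
      · rw [← neg_sub (u y) (u x), neg_sq]
        exact pow_le_pow_left₀ hd (by linarith) 2
      · positivity
      · exact Real.rpow_le_rpow hxy.le hy3 (by positivity)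
    · intro y hy
      obtain ⟨hy1, hy2, hy3⟩ := hball y hy
      simpa using hy2
  · intro x hx
    simp only [Set.mem_sdiff, mem_ball, dist_zero_right, not_lt] at hx ⊢
    linarith

lemma step_real (N : ℕ) (hN : 2 ≤ N) (s : ℝ) (hs : 1 / 2 < s) :
    ∃ K : ℝ, 0 < K ∧ ∀ u : EuclideanSpace ℝ (Fin N) → ℝ,
    (∀ x y : EuclideanSpace ℝ (Fin N), ‖x‖ ≤ ‖y‖ → ‖y‖ < 1 → u x ≤ u y) →
    gagliardoSq N s u < ⊤ →
    ∀ h : ℝ, 0 < h → h ≤ 1 / 8 → ∀ x₀ y₀ : EuclideanSpace ℝ (Fin N),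
    ‖x₀‖ = 1 - 2 * h → ‖y₀‖ = 1 - h →
    u y₀ - u x₀ ≤ K * Real.sqrt (gagliardoSq N s u).toReal * h ^ (s - 1 / 2) := by
  have : Nonempty (Fin N) := ⟨⟨0, by omega⟩⟩
  have hfin : volume (ball (0 : EuclideanSpace ℝ (Fin N)) 1) ≠ ⊤ := measure_ball_lt_top.ne
  have hω : 0 < (volume (ball (0 : EuclideanSpace ℝ (Fin N)) 1)).toReal :=
    ENNReal.toReal_pos (measure_ball_pos _ _ one_pos).ne' hfin
  set ω := (volume (ball (0 : EuclideanSpace ℝ (Fin N)) 1)).toReal with hωd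
  set c : ℝ := ω ^ 2 * ((1 / 2) ^ N * (1 / 4 ^ N) * (1 / 4 ^ (2 * s)) * (2 * (1 / 2) ^ N)) with hc
  have hcpos : 0 < c := by positivity
  refine ⟨Real.sqrt (1 / c), by positivity, ?_⟩
  intro u hmono hG h h0 h8 x₀ y₀ hx₀ hy₀
  have key := gagliardo_step N hN s hs u hmono h h0 h8 x₀ y₀ hx₀ hy₀
  rw [ENNReal.ofReal_le_iff_le_toReal hG.ne, ← hωd] at key
  set G := (gagliardoSq N s u).toReal
  set d := u y₀ - u x₀ with hdd
  have hd : 0 ≤ d := sub_nonneg.2 (hmono _ _ (by linarith) (by linarith))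
  have hpow : 2 * h * (1 / 2) ^ N ≤ (1 - 2 * h) ^ N - (1 - 4 * h) ^ N := by
    obtain ⟨n, rfl⟩ : ∃ n, N = n + 1 := ⟨N - 1, by omega⟩
    have e1 : (1 - 4 * h) ^ n ≤ (1 - 2 * h) ^ n := pow_le_pow_left₀ (by linarith) (by linarith) n
    have e2 : (1 / 2 : ℝ) ^ n ≤ (1 - 2 * h) ^ n := pow_le_pow_left₀ (by norm_num) (by linarith) n
    have e3 : (1 / 2 : ℝ) ^ n ≤ (1 - 4 * h) ^ n := pow_le_pow_left₀ (by norm_num) (by linarith) n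
    have e4 : (0 : ℝ) < (1 / 2) ^ n := by positivity
    rw [pow_succ, pow_succ, pow_succ]
    nlinarith [mul_le_mul_of_nonneg_right e1 (by linarith : 0 ≤ 1 - 2 * h)]
  have hsplit : (4 * h) ^ ((N : ℝ) + 2 * s) = 4 ^ N * h ^ N * (4 ^ (2 * s) * h ^ (2 * s)) := by
    rw [Real.rpow_add (by positivity), Real.rpow_natCast, mul_pow,
      Real.mul_rpow (by norm_num) h0.le]
  have hbound : d ^ 2 * c * (h / h ^ (2 * s)) ≤ G := by
    refine le_trans (le_of_eq ?_) (le_trans (mul_le_mul_of_nonneg_left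
      (mul_le_mul_of_nonneg_right hpow hω.le) (by positivity)) key)
    rw [hsplit, hc, div_pow, div_pow, one_pow]
    have : (0 : ℝ) < 4 ^ (2 * s) := by positivity
    have : (0 : ℝ) < h ^ (2 * s) := by positivity
    field_simp
  have hh : h / h ^ (2 * s) = 1 / (h ^ (s - 1 / 2)) ^ 2 := by
    rw [← Real.rpow_natCast (h ^ (s - 1 / 2)), ← Real.rpow_mul h0.le]
    have : h ^ (2 * s) = h * h ^ ((s - 1 / 2) * ((2 : ℕ) : ℝ)) := by
      nth_rewrite 2 [← Real.rpow_one h]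
      rw [← Real.rpow_add h0]
      congr 1
      push_cast
      ring
    rw [this]
    have : (0 : ℝ) < h ^ ((s - 1 / 2) * ((2 : ℕ) : ℝ)) := by positivity
    field_simp
  have hG0 : 0 ≤ G := ENNReal.toReal_nonneg
  have ht : 0 < h ^ (s - 1 / 2) := by positivity
  rw [hh] at hbound
  refine (sq_le_sq₀ hd (by positivity)).1 ?_
  rw [mul_pow, mul_pow, Real.sq_sqrt (by positivity), Real.sq_sqrt hG0]
  have := mul_le_mul_of_nonneg_right hbound (by positivity : 0 ≤ 1 / c * (h ^ (s - 1 / 2)) ^ 2)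
  calc d ^ 2 = _ := by field_simp
    _ ≤ _ := this
    _ = _ := by ring

lemma sup_bound (N : ℕ) (hN : 2 ≤ N) (s : ℝ) (hs : 1 / 2 < s) :
    ∃ K : ℝ, 0 < K ∧ ∀ u : EuclideanSpace ℝ (Fin N) → ℝ,
    (∀ x ∈ ball (0 : EuclideanSpace ℝ (Fin N)) 1, 0 ≤ u x) →
    (∀ x y : EuclideanSpace ℝ (Fin N), ‖x‖ ≤ ‖y‖ → ‖y‖ < 1 → u x ≤ u y) →
    sqIntegral N u < ⊤ →
    gagliardoSq N s u < ⊤ →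
    ∀ x ∈ ball (0 : EuclideanSpace ℝ (Fin N)) 1,
    u x ≤ K * (Real.sqrt (sqIntegral N u).toReal + Real.sqrt (gagliardoSq N s u).toReal) := by
  have : Nonempty (Fin N) := ⟨⟨0, by omega⟩⟩
  have hfin : volume (ball (0 : EuclideanSpace ℝ (Fin N)) 1) ≠ ⊤ := measure_ball_lt_top.ne
  have hω : 0 < (volume (ball (0 : EuclideanSpace ℝ (Fin N)) 1)).toReal :=
    ENNReal.toReal_pos (measure_ball_pos _ _ one_pos).ne' hfin
  obtain ⟨K, hK, hstep⟩ := step_real N hN s hs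
  set ω := (volume (ball (0 : EuclideanSpace ℝ (Fin N)) 1)).toReal with hωd
  set θ : ℝ := (1 / 2) ^ (s - 1 / 2) with hθ
  have hθ0 : 0 < θ := by positivity
  have hθ1 : θ < 1 := Real.rpow_lt_one (by norm_num) (by norm_num) (by linarith)
  set m : ℝ := (1 ^ N - (3 / 4) ^ N) * ω with hm
  have hm0 : 0 < m := by
    have : (3 / 4 : ℝ) ^ N < 1 := pow_lt_one₀ (by norm_num) (by norm_num) (by omega)
    apply mul_pos _ hω
    rw [one_pow]; linarith
  refine ⟨Real.sqrt (1 / m) + K / (1 - θ), ?_, ?_⟩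
  · have : 0 < 1 - θ := by linarith
    positivity
  intro u hpos hmono hS hG x hx
  set S := (sqIntegral N u).toReal with hSd
  set G := (gagliardoSq N s u).toReal with hGd
  have hS0 : 0 ≤ S := ENNReal.toReal_nonneg
  have hG0 : 0 ≤ G := ENNReal.toReal_nonneg
  set e : EuclideanSpace ℝ (Fin N) := EuclideanSpace.single ⟨0, by omega⟩ 1 with he
  have hen : ‖e‖ = 1 := by simp [he]
  have hnorm : ∀ r : ℝ, 0 ≤ r → ‖r • e‖ = r := by
    intro r hr
    rw [norm_smul, hen, mul_one, Real.norm_of_nonneg hr]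
  have hsmall : ∀ k : ℕ, (1 / 2 : ℝ) ^ k ≤ 1 := fun k => pow_le_one₀ (by norm_num) (by norm_num)
  -- base
  have hbase : u ((1 - (1 / 2 : ℝ) ^ 2) • e) ≤ Real.sqrt (1 / m) * Real.sqrt S := by
    have hn2 : ‖(1 - (1 / 2 : ℝ) ^ 2) • e‖ = 3 / 4 := by rw [hnorm _ (by norm_num)]; norm_num
    set w := (1 - (1 / 2 : ℝ) ^ 2) • e
    have hw : 0 ≤ u w := hpos _ (by rw [mem_ball, dist_zero_right]; linarith)
    have : ENNReal.ofReal (u w ^ 2 * m) ≤ sqIntegral N u := by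
      rw [ENNReal.ofReal_mul (by positivity)]
      refine le_trans (mul_le_mul_right (shell_volume N hN (3 / 4) 1
        (by norm_num) (by norm_num)) _) ?_
      rw [← setLIntegral_const]
      unfold sqIntegral
      refine le_trans (setLIntegral_mono' (measurableSet_ball.diff measurableSet_ball)
        (g := fun x => ENNReal.ofReal ((u x) ^ 2)) ?_) (lintegral_mono_set Set.sdiff_subset)
      intro y hy
      simp only [Set.mem_sdiff, mem_ball, dist_zero_right, not_lt] at hy
      apply ENNReal.ofReal_le_ofReal
      exact pow_le_pow_left₀ hw (hmono _ _ (by linarith) hy.1) 2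
    rw [ENNReal.ofReal_le_iff_le_toReal hS.ne] at this
    refine (sq_le_sq₀ hw (by positivity)).1 ?_
    rw [mul_pow, Real.sq_sqrt (by positivity), Real.sq_sqrt hS0, one_div, inv_mul_eq_div,
      le_div_iff₀ hm0]
    exact this
  have hind : ∀ n : ℕ, u ((1 - (1 / 2 : ℝ) ^ (n + 2)) • e) ≤
      Real.sqrt (1 / m) * Real.sqrt S + K * Real.sqrt G * ∑ i ∈ Finset.range n, θ ^ i := by
    intro n
    induction n with
    | zero => simpa using hbase
    | succ n ih =>
      have hp3 : (1 / 2 : ℝ) ^ (n + 3) ≤ 1 / 8 := by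
        rw [pow_add]; have := hsmall n; norm_num at this ⊢; linarith
      have h2 := hsmall (n + 2)
      have e2 : (1 / 2 : ℝ) ^ (n + 2) = 2 * (1 / 2 : ℝ) ^ (n + 3) := by ring
      have := hstep u hmono hG ((1 / 2) ^ (n + 3)) (by positivity) hp3
        ((1 - (1 / 2 : ℝ) ^ (n + 2)) • e) ((1 - (1 / 2 : ℝ) ^ (n + 3)) • e)
        (by rw [hnorm _ (by linarith), e2]) (by rw [hnorm _ (by linarith)])
      have hpw : ((1 / 2 : ℝ) ^ (n + 3)) ^ (s - 1 / 2) = θ ^ (n + 3) := by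
        rw [hθ, ← Real.rpow_natCast, ← Real.rpow_natCast, ← Real.rpow_mul (by norm_num),
          ← Real.rpow_mul (by norm_num), mul_comm]
      rw [hpw, ← hGd] at this
      have hle : θ ^ (n + 3) ≤ θ ^ n := pow_le_pow_of_le_one hθ0.le hθ1.le (by omega)
      have := mul_le_mul_of_nonneg_left hle (by positivity : 0 ≤ K * Real.sqrt G)
      rw [Finset.sum_range_succ, mul_add, show n + 1 + 2 = n + 3 by ring]
      linarith
  have hgeo : ∀ n : ℕ, ∑ i ∈ Finset.range n, θ ^ i ≤ 1 / (1 - θ) := by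
    intro n
    have h1 : 0 < 1 - θ := by linarith
    rw [le_div_iff₀ h1, geom_sum_mul_neg]
    have : 0 < θ ^ n := by positivity
    linarith
  rw [mem_ball, dist_zero_right] at hx
  obtain ⟨n, hn⟩ := exists_pow_lt_of_lt_one (show 0 < 1 - ‖x‖ by linarith)
    (show (1 / 2 : ℝ) < 1 by norm_num)
  have hn2 : (1 / 2 : ℝ) ^ (n + 2) ≤ (1 / 2) ^ n :=
    pow_le_pow_of_le_one (by norm_num) (by norm_num) (by omega)
  have hp : (0 : ℝ) < (1 / 2) ^ (n + 2) := by positivity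
  have hnn := hnorm (1 - (1 / 2 : ℝ) ^ (n + 2)) (by linarith [hsmall (n + 2)])
  have h1 : u x ≤ u ((1 - (1 / 2 : ℝ) ^ (n + 2)) • e) :=
    hmono _ _ (by linarith) (by linarith)
  have h2 := hind n
  have h3 := mul_le_mul_of_nonneg_left (hgeo n) (by positivity : 0 ≤ K * Real.sqrt G)
  have h4 : 0 ≤ Real.sqrt (1 / m) * Real.sqrt G := by positivity
  have h5 : 0 ≤ K / (1 - θ) * Real.sqrt S := by
    have : 0 < 1 - θ := by linarith
    positivity
  have h6 : K * Real.sqrt G * (1 / (1 - θ)) = K / (1 - θ) * Real.sqrt G := by ring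
  linarith

lemma weight_finite (N : ℕ) (hN : 2 ≤ N) (a : ℝ → ℝ)
    (haInt : IntegrableOn a (Set.Ioo (0 : ℝ) 1)) :
    ∫⁻ x in ball (0 : EuclideanSpace ℝ (Fin N)) 1, ENNReal.ofReal (a ‖x‖) < ⊤ := by
  have : Nonempty (Fin N) := ⟨⟨0, by omega⟩⟩
  have h1 : Integrable (fun x : EuclideanSpace ℝ (Fin N) => (Set.Iio (1 : ℝ)).indicator a ‖x‖) := by
    rw [integrable_fun_norm_addHaar, finrank_euclideanSpace_fin]
    have h2 : (fun y : ℝ => y ^ (N - 1) • (Set.Iio (1 : ℝ)).indicator a y) =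
        (Set.Iio (1 : ℝ)).indicator (fun y => y ^ (N - 1) * a y) := by
      ext y
      by_cases hy : y ∈ Set.Iio (1 : ℝ) <;> simp [hy]
    rw [h2, integrableOn_indicator_iff measurableSet_Iio, Set.inter_comm, Set.Ioi_inter_Iio]
    refine Integrable.bdd_mul (c := 1) haInt (by fun_prop) ?_
    filter_upwards [ae_restrict_mem measurableSet_Ioo] with y hy
    rw [norm_pow, Real.norm_of_nonneg hy.1.le]
    exact pow_le_one₀ hy.1.le hy.2.le
  refine lt_of_le_of_lt ?_ (h1.lintegral_lt_top)
  refine le_trans (setLIntegral_mono' measurableSet_ball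
    (g := fun x => ENNReal.ofReal ((Set.Iio (1 : ℝ)).indicator a ‖x‖)) ?_)
    (setLIntegral_le_lintegral _ _)
  intro x hx
  rw [mem_ball, dist_zero_right] at hx
  rw [Set.indicator_of_mem (Set.mem_Iio.2 hx)]

lemma weighted_bound (N : ℕ) (a : ℝ → ℝ) (p : ℝ) (hp : 2 ≤ p)
    (u : EuclideanSpace ℝ (Fin N) → ℝ) (M : ℝ)
    (hpos : ∀ x ∈ ball (0 : EuclideanSpace ℝ (Fin N)) 1, 0 ≤ u x) (hM0 : 0 ≤ M)
    (hM : ∀ x ∈ ball (0 : EuclideanSpace ℝ (Fin N)) 1, u x ≤ M) :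
    (∫⁻ x in ball (0 : EuclideanSpace ℝ (Fin N)) 1,
      ENNReal.ofReal (a ‖x‖ * |u x| ^ p)) ^ (1 / p) ≤
    (∫⁻ x in ball (0 : EuclideanSpace ℝ (Fin N)) 1, ENNReal.ofReal (a ‖x‖)) ^ (1 / p) *
      ENNReal.ofReal M := by
  have hp0 : 0 < p := by linarith
  have h1 : ∫⁻ x in ball (0 : EuclideanSpace ℝ (Fin N)) 1, ENNReal.ofReal (a ‖x‖ * |u x| ^ p) ≤
      (∫⁻ x in ball (0 : EuclideanSpace ℝ (Fin N)) 1, ENNReal.ofReal (a ‖x‖)) *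
      ENNReal.ofReal (M ^ p) := by
    rw [← lintegral_mul_const' _ _ ENNReal.ofReal_ne_top]
    refine setLIntegral_mono' measurableSet_ball ?_
    intro x hx
    rw [ENNReal.ofReal_mul' (by positivity)]
    refine mul_le_mul_right (ENNReal.ofReal_le_ofReal ?_) _
    rw [abs_of_nonneg (hpos x hx)]
    exact Real.rpow_le_rpow (hpos x hx) (hM x hx) hp0.le
  refine le_trans (ENNReal.rpow_le_rpow h1 (by positivity)) ?_
  rw [ENNReal.mul_rpow_of_nonneg _ _ (by positivity),
    ENNReal.ofReal_rpow_of_nonneg (by positivity) (by positivity), ← Real.rpow_mul hM0,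
    mul_one_div_cancel hp0.ne', Real.rpow_one]

/-- Lemma 3.1(ii): the full norm `‖u‖_V`, consisting of the `L²` norm together
with the weighted `L^p_a` and `L^q_b` norms, is controlled on the cone of non-negative,
radial, radially non-decreasing functions by the `L²` norm plus the Gagliardo seminorm. -/
theorem weighted_norm_equivalence_on_cone
    (N : ℕ) (hN : 2 ≤ N) (s : ℝ) (hs : 1 / 2 < s) (hs1 : s < 1)
    (p q : ℝ) (hp : 2 ≤ p) (hq : 2 ≤ q)
    (a b : ℝ → ℝ)
    (haInt : IntegrableOn a (Set.Ioo (0 : ℝ) 1))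
    (haMono : MonotoneOn a (Set.Ioo (0 : ℝ) 1))
    (haPos : ∀ᵐ r ∂(volume.restrict (Set.Ioo (0 : ℝ) 1)), 0 < a r)
    (hbInt : IntegrableOn b (Set.Ioo (0 : ℝ) 1))
    (hbAnti : AntitoneOn b (Set.Ioo (0 : ℝ) 1))
    (hbNonneg : ∀ r ∈ Set.Ioo (0 : ℝ) 1, 0 ≤ b r) :
    ∃ C : ℝ, 0 < C ∧
      ∀ u : EuclideanSpace ℝ (Fin N) → ℝ, Measurable u →
        (∀ x y : EuclideanSpace ℝ (Fin N), ‖x‖ = ‖y‖ → u x = u y) →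
        (∀ x ∈ ball (0 : EuclideanSpace ℝ (Fin N)) 1, 0 ≤ u x) →
        (∀ x y : EuclideanSpace ℝ (Fin N), ‖x‖ ≤ ‖y‖ → ‖y‖ < 1 → u x ≤ u y) →
        sqIntegral N u < ⊤ →
        gagliardoSq N s u < ⊤ →
        (sqIntegral N u) ^ (1 / 2 : ℝ) +
          (∫⁻ x in ball (0 : EuclideanSpace ℝ (Fin N)) 1,
              ENNReal.ofReal (a ‖x‖ * |u x| ^ p)) ^ (1 / p) +
          (∫⁻ x in ball (0 : EuclideanSpace ℝ (Fin N)) 1,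
              ENNReal.ofReal (b ‖x‖ * |u x| ^ q)) ^ (1 / q) ≤
        ENNReal.ofReal C *
          ((sqIntegral N u) ^ (1 / 2 : ℝ) + (gagliardoSq N s u) ^ (1 / 2 : ℝ)) := by
  obtain ⟨K, hK, hsup⟩ := sup_bound N hN s hs
  have hA := (ENNReal.rpow_lt_top_of_nonneg (y := 1 / p) (by positivity)
    (weight_finite N hN a haInt).ne).ne
  have hB := (ENNReal.rpow_lt_top_of_nonneg (y := 1 / q) (by positivity)
    (weight_finite N hN b hbInt).ne).ne
  set A := (∫⁻ x in ball (0 : EuclideanSpace ℝ (Fin N)) 1, ENNReal.ofReal (a ‖x‖)) ^ (1 / p)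
    with hAd
  set B := (∫⁻ x in ball (0 : EuclideanSpace ℝ (Fin N)) 1, ENNReal.ofReal (b ‖x‖)) ^ (1 / q)
    with hBd
  refine ⟨1 + A.toReal * K + B.toReal * K, by positivity, ?_⟩
  intro u _ _ hpos hmono hS hG
  have hb := hsup u hpos hmono hS hG
  set T : ENNReal := (sqIntegral N u) ^ (1 / 2 : ℝ) + (gagliardoSq N s u) ^ (1 / 2 : ℝ) with hT
  set M := K * (Real.sqrt (sqIntegral N u).toReal + Real.sqrt (gagliardoSq N s u).toReal) with hM
  have hMT : ENNReal.ofReal M = ENNReal.ofReal K * T := by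
    rw [hM, ENNReal.ofReal_mul hK.le, ENNReal.ofReal_add (by positivity) (by positivity),
      Real.sqrt_eq_rpow, Real.sqrt_eq_rpow,
      ← ENNReal.ofReal_rpow_of_nonneg ENNReal.toReal_nonneg (by norm_num),
      ← ENNReal.ofReal_rpow_of_nonneg ENNReal.toReal_nonneg (by norm_num),
      ENNReal.ofReal_toReal hS.ne, ENNReal.ofReal_toReal hG.ne]
  have h1 := weighted_bound N a p hp u M hpos (by positivity) hb
  have h2 := weighted_bound N b q hq u M hpos (by positivity) hb
  rw [← hAd, hMT] at h1
  rw [← hBd, hMT] at h2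
  rw [ENNReal.ofReal_add (by positivity) (by positivity),
    ENNReal.ofReal_add (by positivity) (by positivity), ENNReal.ofReal_mul (by positivity),
    ENNReal.ofReal_mul (by positivity), ENNReal.ofReal_toReal hA, ENNReal.ofReal_toReal hB,
    ENNReal.ofReal_one, add_mul, add_mul, one_mul, mul_assoc, mul_assoc]
  exact add_le_add (add_le_add le_self_add h1) h2
end
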